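/- The variety CT_n^0, defined as the Zariski closure of the set of pairs (X,Y) of commuting upper triangular matrices with both X and Y regular (i.e., having minimal polynomial of degree n), is irreducible of dimension n(n+3)/2. -/

import Mathlib

open Matrix Polynomial

/-- Points of the affine space `T_n × T_n` (resp. `U_n × U_n`), encoded as functions
from (index pairs for X) ⊕ (index pairs for Y) to the field. -/
abbrev Pt (n : ℕ) (K : Type*) := ((Fin n × Fin n) ⊕ (Fin n × Fin n)) → K

/-- The Zariski topology on the affine space of pairs of matrices: generated by
complements of zero loci of polynomials. -/
noncomputable instance ptTop (n : ℕ) (K : Type*) [CommRing K] : TopologicalSpace (Pt n K) :=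
  TopologicalSpace.generateFrom
    { U | ∃ p : MvPolynomial ((Fin n × Fin n) ⊕ (Fin n × Fin n)) K,
        U = {x | MvPolynomial.eval x p ≠ 0} }

/-- The first matrix of the pair encoded by a point. -/
def Xof {n : ℕ} {K : Type*} (x : Pt n K) : Matrix (Fin n) (Fin n) K :=
  Matrix.of fun i j => x (Sum.inl (i, j))

/-- The second matrix of the pair encoded by a point. -/
def Yof {n : ℕ} {K : Type*} (x : Pt n K) : Matrix (Fin n) (Fin n) K :=
  Matrix.of fun i j => x (Sum.inr (i, j))

/-- `CT_n`: pairs of commuting upper triangular matrices. -/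
def CTset (n : ℕ) (K : Type*) [CommRing K] : Set (Pt n K) :=
  {x | (∀ i j, j < i → Xof x i j = 0) ∧ (∀ i j, j < i → Yof x i j = 0) ∧
    Xof x * Yof x = Yof x * Xof x}

/-- `NT_n`: pairs of commuting strictly upper triangular matrices. -/
def NTset (n : ℕ) (K : Type*) [CommRing K] : Set (Pt n K) :=
  {x | (∀ i j, j ≤ i → Xof x i j = 0) ∧ (∀ i j, j ≤ i → Yof x i j = 0) ∧
    Xof x * Yof x = Yof x * Xof x}

/-- `CT_n^0`: the Zariski closure of the set of commuting pairs of regular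
(minimal polynomial of degree `n`) upper triangular matrices. -/
def CT0 (n : ℕ) (K : Type*) [Field K] : Set (Pt n K) :=
  closure {x | x ∈ CTset n K ∧ (minpoly K (Xof x)).natDegree = n ∧
    (minpoly K (Yof x)).natDegree = n}

/-- An injective integral ring extension preserves Krull dimension. -/
theorem ringKrullDim_eq_of_isIntegral (R S : Type*) [CommRing R] [CommRing S] [Algebra R S]
    [Algebra.IsIntegral R S] (hinj : Function.Injective (algebraMap R S)) :
    ringKrullDim S = ringKrullDim R := by
  apply le_antisymm
  · refine Order.krullDim_le_of_strictMono (PrimeSpectrum.comap (algebraMap R S)) ?_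
    intro I J hIJ
    exact Ideal.IsIntegral.comap_lt_comap (R := R) hIJ
  · refine iSup_le fun l ↦ ?_
    obtain ⟨Q, -, hQ, hQl⟩ := Ideal.exists_ideal_over_prime_of_isIntegral (S := S)
      l.head.asIdeal ⊥ (by
        rw [← RingHom.ker_eq_comap_bot, (RingHom.injective_iff_ker_eq_bot _).mp hinj]
        exact bot_le)
    have : Q.LiesOver l.head.asIdeal := ⟨hQl.symm⟩
    obtain ⟨L, hL, -⟩ := Ideal.exists_ltSeries_of_hasGoingUp l Q
    rw [← hL]
    exact Order.LTSeries.length_le_krullDim L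

/-- The Krull dimension of a finitely generated domain over a field is its transcendence
degree. -/
theorem ringKrullDim_eq_of_trdeg_eq (k A : Type*) [Field k] [CommRing A] [IsDomain A]
    [Algebra k A] [Algebra.FiniteType k A] {d : ℕ} (h : Algebra.trdeg k A = d) :
    ringKrullDim A = d := by
  obtain ⟨s, g, hg, hint⟩ := exists_integral_inj_algHom_of_fg k A
  let _ := g.toRingHom.toAlgebra
  have : IsScalarTower k (MvPolynomial (Fin s) k) A :=
    IsScalarTower.of_algebraMap_eq fun r ↦ (g.commutes r).symm
  have : Algebra.IsIntegral (MvPolynomial (Fin s) k) A := ⟨hint⟩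
  have : FaithfulSMul (MvPolynomial (Fin s) k) A :=
    (faithfulSMul_iff_algebraMap_injective _ _).mpr hg
  have hs := lift_trdeg_add_eq k (MvPolynomial (Fin s) k) A
  rw [MvPolynomial.trdeg_of_isDomain, trdeg_eq_zero, h] at hs
  have hsd : s = d := by simpa using hs
  rw [ringKrullDim_eq_of_isIntegral (MvPolynomial (Fin s) k) A hg,
    MvPolynomial.ringKrullDim_of_isNoetherianRing, ringKrullDim_eq_zero_of_field, ← hsd]
  simp

section Zariski

variable {n : ℕ} {K : Type*} [Field K]

/-- Polynomial functions on pairs of `n × n` matrices. -/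
local notation "𝓡" => MvPolynomial ((Fin n × Fin n) ⊕ (Fin n × Fin n)) K

theorem isOpen_eval_ne_zero (p : 𝓡) : IsOpen {x : Pt n K | MvPolynomial.eval x p ≠ 0} :=
  TopologicalSpace.isOpen_generateFrom_of_mem ⟨p, rfl⟩

theorem isTopologicalBasis_eval_ne_zero : TopologicalSpace.IsTopologicalBasis
    {U : Set (Pt n K) | ∃ p : 𝓡, U = {x | MvPolynomial.eval x p ≠ 0}} where
  exists_subset_inter := by
    rintro _ ⟨p, rfl⟩ _ ⟨q, rfl⟩ x hx
    refine ⟨_, ⟨p * q, rfl⟩, ?_, ?_⟩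
    · simpa using hx
    · intro y hy
      simpa using hy
  sUnion_eq := Set.eq_univ_of_forall fun x ↦ ⟨_, ⟨1, rfl⟩, by simp⟩
  eq_generateFrom := rfl

theorem exists_eval_ne_zero_of_isOpen {U : Set (Pt n K)} (hU : IsOpen U) {x : Pt n K}
    (hx : x ∈ U) : ∃ p : 𝓡, MvPolynomial.eval x p ≠ 0 ∧
      ∀ y : Pt n K, MvPolynomial.eval y p ≠ 0 → y ∈ U := by
  obtain ⟨_, ⟨p, rfl⟩, hxp, hpU⟩ :=
    isTopologicalBasis_eval_ne_zero.exists_subset_of_mem_open hx hU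
  exact ⟨p, hxp, fun y hy ↦ hpU hy⟩

theorem closure_eq_zeroLocus_vanishingIdeal (S : Set (Pt n K)) :
    closure S = MvPolynomial.zeroLocus K (MvPolynomial.vanishingIdeal K S) := by
  ext x
  constructor
  · intro hx p hp
    by_contra hne
    obtain ⟨y, hy, hyS⟩ := mem_closure_iff.mp hx _ (isOpen_eval_ne_zero p) hne
    exact hy (hp y hyS)
  · intro hx
    refine mem_closure_iff.mpr fun U hU hxU ↦ ?_
    obtain ⟨p, hxp, hpU⟩ := exists_eval_ne_zero_of_isOpen hU hxU
    by_contra hemp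
    refine hxp (hx p fun y hyS ↦ ?_)
    by_contra hyp
    exact hemp ⟨y, hpU y hyp, hyS⟩

theorem isClosed_zeroLocus (I : Ideal 𝓡) :
    IsClosed (MvPolynomial.zeroLocus K I : Set (Pt n K)) := by
  refine closure_subset_iff_isClosed.mp ?_
  rw [closure_eq_zeroLocus_vanishingIdeal]
  exact MvPolynomial.zeroLocus_anti_mono (MvPolynomial.le_vanishingIdeal_zeroLocus I)

theorem IsIrreducible.isPrime_vanishingIdeal {S : Set (Pt n K)} (hS : IsIrreducible S) :
    (MvPolynomial.vanishingIdeal K S : Ideal 𝓡).IsPrime := by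
  obtain ⟨x, hx⟩ := hS.nonempty
  refine ⟨fun h ↦ ?_, fun {p q} hpq ↦ ?_⟩
  · have : (1 : 𝓡) ∈ MvPolynomial.vanishingIdeal K S := h ▸ Submodule.mem_top
    simpa using this x hx
  · by_contra! h
    simp only [MvPolynomial.mem_vanishingIdeal_iff, not_forall] at h
    obtain ⟨⟨y, hyS, hy⟩, ⟨z, hzS, hz⟩⟩ := h
    obtain ⟨w, hwS, hwp, hwq⟩ := hS.isPreirreducible _ _ (isOpen_eval_ne_zero p)
      (isOpen_eval_ne_zero q) ⟨y, hyS, hy⟩ ⟨z, hzS, hz⟩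
    have := hpq w hwS
    rw [map_mul] at this
    exact (mul_ne_zero hwp hwq) this

variable [IsAlgClosed K]

theorem isIrreducible_zeroLocus (P : Ideal 𝓡) [hP : P.IsPrime] :
    IsIrreducible (MvPolynomial.zeroLocus K P : Set (Pt n K)) := by
  have hV := MvPolynomial.IsPrime.vanishingIdeal_zeroLocus (K := K) P
  have key : ∀ p ∉ P, ∃ x ∈ (MvPolynomial.zeroLocus K P : Set (Pt n K)),
      MvPolynomial.eval x p ≠ 0 := by
    intro p hp
    rw [← hV] at hp
    simpa only [MvPolynomial.mem_vanishingIdeal_iff, not_forall, exists_prop] using! hp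
  refine ⟨?_, ?_⟩
  · obtain ⟨x, hx, -⟩ := key 1 ((Ideal.ne_top_iff_one _).mp hP.ne_top)
    exact ⟨x, hx⟩
  · rintro U V hU hV ⟨x, hxP, hxU⟩ ⟨y, hyP, hyV⟩
    obtain ⟨p, hxp, hpU⟩ := exists_eval_ne_zero_of_isOpen hU hxU
    obtain ⟨q, hyq, hqV⟩ := exists_eval_ne_zero_of_isOpen hV hyV
    obtain ⟨z, hz, hpq⟩ := key (p * q) fun h ↦
      (hP.mem_or_mem h).elim (fun h ↦ hxp (hxP p h)) (fun h ↦ hyq (hyP q h))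
    rw [map_mul] at hpq
    exact ⟨z, hz, hpU z (left_ne_zero_of_mul hpq), hqV z (right_ne_zero_of_mul hpq)⟩

open TopologicalSpace in
theorem topologicalKrullDim_zeroLocus (P : Ideal 𝓡) [P.IsPrime] :
    topologicalKrullDim (MvPolynomial.zeroLocus K P : Set (Pt n K)) =
      ringKrullDim (𝓡 ⧸ P) := by
  rw [ringKrullDim_quotient, ← Order.krullDim_orderDual, topologicalKrullDim]
  apply le_antisymm
  · let f (T : IrreducibleCloseds (MvPolynomial.zeroLocus K P : Set (Pt n K))) :
        (PrimeSpectrum.zeroLocus (P : Set 𝓡))ᵒᵈ := OrderDual.toDual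
      ⟨⟨MvPolynomial.vanishingIdeal K (Subtype.val '' T.carrier),
        (T.isIrreducible.image _ continuous_subtype_val.continuousOn).isPrime_vanishingIdeal⟩,
        fun p hp ↦ by
          rintro _ ⟨x, -, rfl⟩
          exact x.2 p hp⟩
    refine Order.krullDim_le_of_strictMono f (Monotone.strictMono_of_injective ?_ ?_)
    · intro T T' h
      exact MvPolynomial.vanishingIdeal_anti_mono (Set.image_mono h)
    · intro T T' h
      refine IrreducibleCloseds.map_injective_of_isInducing Topology.IsInducing.subtypeVal ?_
      apply SetLike.coe_injective
      simp only [IrreducibleCloseds.coe_map, closure_eq_zeroLocus_vanishingIdeal]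
      have h' := congrArg (fun Q ↦ (OrderDual.ofDual Q).1.asIdeal) h
      exact congrArg (MvPolynomial.zeroLocus K) h'
  · have himg (Q : PrimeSpectrum.zeroLocus (P : Set 𝓡)) :
        Subtype.val '' (Subtype.val ⁻¹' (MvPolynomial.zeroLocus K Q.1.asIdeal : Set (Pt n K)) :
          Set (MvPolynomial.zeroLocus K P : Set (Pt n K))) =
        MvPolynomial.zeroLocus K Q.1.asIdeal := by
      rw [Subtype.image_preimage_coe, Set.inter_eq_right]
      exact MvPolynomial.zeroLocus_anti_mono Q.2
    let g (Q : (PrimeSpectrum.zeroLocus (P : Set 𝓡))ᵒᵈ) :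
        IrreducibleCloseds (MvPolynomial.zeroLocus K P : Set (Pt n K)) :=
      { carrier := Subtype.val ⁻¹' (MvPolynomial.zeroLocus K (OrderDual.ofDual Q).1.asIdeal :
          Set (Pt n K))
        isIrreducible' := by
          have hirr := isIrreducible_zeroLocus (OrderDual.ofDual Q).1.asIdeal
          rw [← himg (OrderDual.ofDual Q)] at hirr
          refine ⟨hirr.nonempty.of_image, ?_⟩
          rintro _ _ ⟨U, hU, rfl⟩ ⟨V, hV, rfl⟩ ⟨x, hx, hxU⟩ ⟨y, hy, hyV⟩
          obtain ⟨_, ⟨z, hz, rfl⟩, hzU, hzV⟩ := hirr.isPreirreducible U V hU hV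
            ⟨x, ⟨x, hx, rfl⟩, hxU⟩ ⟨y, ⟨y, hy, rfl⟩, hyV⟩
          exact ⟨z, hz, hzU, hzV⟩
        isClosed' := (isClosed_zeroLocus _).preimage continuous_subtype_val }
    refine Order.krullDim_le_of_strictMono g (Monotone.strictMono_of_injective ?_ ?_)
    · intro Q Q' h
      exact fun x hx ↦ MvPolynomial.zeroLocus_anti_mono h hx
    · intro Q Q' h
      have h' := congrArg (fun T ↦ MvPolynomial.vanishingIdeal K (Subtype.val '' T.carrier)) h
      simp only [g, himg, MvPolynomial.IsPrime.vanishingIdeal_zeroLocus] at h'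
      exact OrderDual.ofDual.injective (Subtype.ext (PrimeSpectrum.ext h'))

end Zariski

section Krylov

variable {n : ℕ} {R K : Type*} [CommRing R] [Field K]

/-- The matrix with columns `v, A v, …, A ^ (n - 1) v`. -/
def krylov (A : Matrix (Fin n) (Fin n) R) (v : Fin n → R) : Matrix (Fin n) (Fin n) R :=
  Matrix.of fun i j ↦ (A ^ (j : ℕ) *ᵥ v) i

theorem krylov_mulVec (A : Matrix (Fin n) (Fin n) R) (v c : Fin n → R) :
    krylov A v *ᵥ c = (∑ k, c k • A ^ (k : ℕ)) *ᵥ v := by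
  rw [Matrix.sum_mulVec]
  ext i
  simp [krylov, Matrix.mulVec, dotProduct, Finset.sum_apply, Finset.mul_sum, mul_comm,
    mul_left_comm]

theorem mul_krylov_of_commute {A B : Matrix (Fin n) (Fin n) R} (h : Commute A B)
    (v : Fin n → R) : B * krylov A v = krylov A (B *ᵥ v) := by
  ext i j
  change (B *ᵥ (A ^ (j : ℕ) *ᵥ v)) i = (A ^ (j : ℕ) *ᵥ (B *ᵥ v)) i
  rw [Matrix.mulVec_mulVec, Matrix.mulVec_mulVec, (h.pow_left j).eq]

theorem krylov_map {R' : Type*} [CommRing R'] (f : R →+* R') (A : Matrix (Fin n) (Fin n) R)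
    (v : Fin n → R) : krylov (A.map f) (f ∘ v) = (krylov A v).map f := by
  ext i j
  simp only [krylov, Matrix.of_apply, Matrix.map_apply, RingHom.map_mulVec, Matrix.map_pow]

theorem natDegree_minpoly_matrix_le (A : Matrix (Fin n) (Fin n) K) :
    (minpoly K A).natDegree ≤ n := by
  have := Polynomial.natDegree_le_of_dvd (Matrix.minpoly_dvd_charpoly A)
    A.charpoly_monic.ne_zero
  simpa [Matrix.charpoly_natDegree_eq_dim] using this

theorem aeval_mulVec_eq_krylov_mulVec (A : Matrix (Fin n) (Fin n) R) (v : Fin n → R) {p : R[X]}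
    (hp : p.natDegree < n) : aeval A p *ᵥ v = krylov A v *ᵥ fun k ↦ p.coeff k := by
  rw [krylov_mulVec, Polynomial.aeval_eq_sum_range' hp, Finset.sum_range]

theorem natDegree_minpoly_eq_of_det_krylov_ne_zero {A : Matrix (Fin n) (Fin n) K}
    {v : Fin n → K} (h : (krylov A v).det ≠ 0) : (minpoly K A).natDegree = n := by
  refine (natDegree_minpoly_matrix_le A).antisymm (not_lt.mp fun hlt ↦ h ?_)
  refine Matrix.exists_mulVec_eq_zero_iff.mp ⟨_, ?_, by
    rw [← aeval_mulVec_eq_krylov_mulVec A v hlt, minpoly.aeval, Matrix.zero_mulVec]⟩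
  intro h0
  have := congrFun h0 ⟨_, hlt⟩
  have hm : (minpoly K A).coeff (minpoly K A).natDegree = 1 :=
    minpoly.monic (Matrix.isIntegral A)
  simp [hm] at this

/-- A matrix whose minimal polynomial has full degree admits a cyclic vector. -/
theorem exists_det_krylov_ne_zero [IsAlgClosed K] {A : Matrix (Fin n) (Fin n) K}
    (h : (minpoly K A).natDegree = n) : ∃ v, (krylov A v).det ≠ 0 := by
  classical
  set m := minpoly K A with hm
  have hmonic : m.Monic := minpoly.monic (Matrix.isIntegral A)
  let s : Finset (Submodule K (Fin n → K)) := m.roots.toFinset.image fun a ↦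
    LinearMap.ker (Matrix.mulVecLin (aeval A (m /ₘ (X - C a))))
  have hs : ⊤ ∉ s := by
    intro hmem
    obtain ⟨a, ha, hker⟩ := Finset.mem_image.mp hmem
    have ha' : m.IsRoot a := (Polynomial.mem_roots'.mp (Multiset.mem_toFinset.mp ha)).2
    have hmul := Polynomial.mul_divByMonic_eq_iff_isRoot.mpr ha'
    have hne : m /ₘ (X - C a) ≠ 0 := by
      intro h0
      rw [h0, mul_zero] at hmul
      exact hmonic.ne_zero hmul.symm
    have hzero : aeval A (m /ₘ (X - C a)) = 0 := by
      rw [LinearMap.ker_eq_top] at hker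
      exact Matrix.ext_iff_mulVec.mpr fun v ↦ by simpa using LinearMap.congr_fun hker v
    have hdeg := Polynomial.natDegree_le_natDegree (minpoly.degree_le_of_ne_zero K A hne hzero)
    rw [← hm] at hdeg
    have := congrArg natDegree hmul
    rw [Polynomial.natDegree_mul (X_sub_C_ne_zero a) hne, natDegree_X_sub_C] at this
    omega
  obtain ⟨v, hv⟩ := (Set.ne_univ_iff_exists_notMem _).mp
    (Subspace.biUnion_ne_univ_of_top_notMem hs)
  have hv' : ∀ a, m.IsRoot a → aeval A (m /ₘ (X - C a)) *ᵥ v ≠ 0 := by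
    intro a ha h0
    refine hv (Set.mem_biUnion (x := LinearMap.ker (Matrix.mulVecLin
      (aeval A (m /ₘ (X - C a))))) (Finset.mem_image_of_mem _ ?_) ?_)
    · exact Multiset.mem_toFinset.mpr (Polynomial.mem_roots'.mpr ⟨hmonic.ne_zero, ha⟩)
    · simpa using! h0
  refine ⟨v, fun hdet ↦ ?_⟩
  obtain ⟨c, hc0, hc⟩ := Matrix.exists_mulVec_eq_zero_iff.mpr hdet
  let p : K[X] := ∑ k : Fin n, C (c k) * X ^ (k : ℕ)
  have hpv : aeval A p *ᵥ v = 0 := by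
    rw [← hc, krylov_mulVec]
    simp [p, Algebra.smul_def]
  have hp0 : p ≠ 0 := by
    intro hp
    refine hc0 (funext fun k ↦ ?_)
    have := congrArg (fun q ↦ q.coeff (k : ℕ)) hp
    simpa [p, Polynomial.finsetSum_coeff, Polynomial.coeff_X_pow, Fin.val_inj] using this
  have hpdeg : p.degree < n := by
    refine (Polynomial.degree_sum_le _ _).trans_lt ?_
    refine (Finset.sup_lt_iff (WithBot.bot_lt_coe n)).mpr fun k _ ↦ ?_
    exact (Polynomial.degree_C_mul_X_pow_le _ _).trans_lt (WithBot.coe_lt_coe.mpr k.2)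
  let g := EuclideanDomain.gcd p m
  obtain ⟨q, hq⟩ : g ∣ m := EuclideanDomain.gcd_dvd_right p m
  have hgv : aeval A g *ᵥ v = 0 := by
    have hg : g = _ := EuclideanDomain.gcd_eq_gcd_ab p m
    rw [hg, mul_comm p, map_add, map_mul, map_mul, minpoly.aeval, zero_mul, add_zero,
      ← Matrix.mulVec_mulVec, hpv, Matrix.mulVec_zero]
  have hgdeg : g.degree < n :=
    (Polynomial.degree_le_of_dvd (EuclideanDomain.gcd_dvd_left p m) hp0).trans_lt hpdeg
  have hqdeg : q.degree ≠ 0 := by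
    intro h0
    have := congrArg degree hq
    rw [Polynomial.degree_mul, h0, add_zero,
      Polynomial.degree_eq_natDegree hmonic.ne_zero, h] at this
    exact hgdeg.ne this.symm
  obtain ⟨a, ha⟩ := IsAlgClosed.exists_root q hqdeg
  obtain ⟨r, hr⟩ := Polynomial.dvd_iff_isRoot.mpr ha
  have hmr : m = (X - C a) * (r * g) := by rw [hq, hr]; ring
  refine hv' a (by rw [hmr]; simp) ?_
  rw [hmr, Polynomial.mul_divByMonic_cancel_left _ (monic_X_sub_C a), map_mul,
    ← Matrix.mulVec_mulVec, hgv, Matrix.mulVec_zero]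

/-- The centralizer of a regular matrix consists of polynomials in that matrix. -/
theorem exists_eq_sum_smul_pow_of_commute [IsAlgClosed K] {A B : Matrix (Fin n) (Fin n) K}
    (h : (minpoly K A).natDegree = n) (hAB : Commute A B) :
    ∃ c : Fin n → K, B = ∑ k, c k • A ^ (k : ℕ) := by
  obtain ⟨v, hv⟩ := exists_det_krylov_ne_zero h
  have hu : IsUnit (krylov A v).det := hv.isUnit
  refine ⟨(krylov A v)⁻¹ *ᵥ (B *ᵥ v), sub_eq_zero.mp ?_⟩
  set Z := B - ∑ k, ((krylov A v)⁻¹ *ᵥ (B *ᵥ v)) k • A ^ (k : ℕ) with hZ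
  have hcomm : Commute A Z :=
    hAB.sub_right (Commute.sum_right _ _ _ fun k _ ↦ (Commute.self_pow A k).smul_right _)
  have hZv : Z *ᵥ v = 0 := by
    rw [hZ, Matrix.sub_mulVec, ← krylov_mulVec, Matrix.mulVec_mulVec,
      Matrix.mul_nonsing_inv _ hu, Matrix.one_mulVec, sub_self]
  have hmul : Z * krylov A v = 0 := by
    rw [mul_krylov_of_commute hcomm, hZv]
    ext i j
    simp [krylov]
  rw [← Matrix.mul_nonsing_inv_cancel_right _ Z hu, hmul, Matrix.zero_mul]

end Krylov

section Parametrization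

variable {n : ℕ} {R : Type*} [CommRing R]

/-- Coordinates on the affine space `T_n × K ^ n`. -/
abbrev ParamIndex (n : ℕ) := {p : Fin n × Fin n // p.1 ≤ p.2} ⊕ Fin n

/-- The upper triangular matrix with prescribed entries. -/
def upperPart (a : ParamIndex n → R) : Matrix (Fin n) (Fin n) R :=
  Matrix.of fun i j ↦ if h : i ≤ j then a (Sum.inl ⟨(i, j), h⟩) else 0

/-- The polynomial in `upperPart a` whose coefficients are the remaining coordinates of `a`. -/
def polyPart (a : ParamIndex n → R) : Matrix (Fin n) (Fin n) R :=
  ∑ k : Fin n, a (Sum.inr k) • upperPart a ^ (k : ℕ)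

/-- The map `(X, c) ↦ (X, ∑ k, c k • X ^ k)` parametrizing commuting pairs. -/
def paramPair (a : ParamIndex n → R) : Pt n R :=
  Sum.elim (fun p ↦ upperPart a p.1 p.2) (fun p ↦ polyPart a p.1 p.2)

theorem upperPart_map {R' : Type*} [CommRing R'] (f : R →+* R') (a : ParamIndex n → R) :
    (upperPart a).map f = upperPart (f ∘ a) := by
  ext i j
  by_cases h : i ≤ j <;> simp [upperPart, h]

theorem polyPart_map {R' : Type*} [CommRing R'] (f : R →+* R') (a : ParamIndex n → R) :
    (polyPart a).map f = polyPart (f ∘ a) := by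
  rw [polyPart, polyPart, ← RingHom.mapMatrix_apply, map_sum, ← upperPart_map]
  refine Finset.sum_congr rfl fun k _ ↦ ?_
  rw [RingHom.mapMatrix_apply, ← Matrix.map_pow]
  ext i j
  simp

theorem paramPair_map {R' : Type*} [CommRing R'] (f : R →+* R') (a : ParamIndex n → R) :
    f ∘ paramPair a = paramPair (f ∘ a) := by
  funext p
  rcases p with p | p
  · exact congrFun (congrFun (upperPart_map f a) p.1) p.2
  · exact congrFun (congrFun (polyPart_map f a) p.1) p.2

theorem upperPart_blockTriangular (a : ParamIndex n → R) :
    (upperPart a).BlockTriangular id := fun i j (h : j < i) ↦ by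
  simp [upperPart, h.not_ge]

theorem polyPart_blockTriangular (a : ParamIndex n → R) :
    (polyPart a).BlockTriangular id := by
  have hpow : ∀ k : ℕ, (upperPart a ^ k).BlockTriangular id := fun k ↦ by
    induction k with
    | zero => rw [pow_zero]; exact Matrix.blockTriangular_one
    | succ k ih => rw [pow_succ]; exact ih.mul (upperPart_blockTriangular a)
  intro i j h
  rw [polyPart, Matrix.sum_apply]
  exact Finset.sum_eq_zero fun k _ ↦ by rw [Matrix.smul_apply, hpow k h, smul_zero]

theorem paramPair_mem_CTset (a : ParamIndex n → R) : paramPair a ∈ CTset n R :=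
  ⟨fun _ _ h ↦ upperPart_blockTriangular a h, fun _ _ h ↦ polyPart_blockTriangular a h,
    (Commute.sum_right _ _ _ fun k _ ↦
      (Commute.self_pow (upperPart a) k).smul_right _ : Commute (upperPart a) (polyPart a))⟩

/-- The last standard basis vector. -/
def lastVec (n : ℕ) (R : Type*) [CommRing R] : Fin n → R :=
  fun i ↦ if (i : ℕ) + 1 = n then 1 else 0

theorem map_comp_lastVec {R' : Type*} [CommRing R'] (f : R →+* R') :
    f ∘ lastVec n R = lastVec n R' := by
  funext i
  simp [lastVec, apply_ite f]

/-- The determinant whose nonvanishing says that the last basis vector is cyclic. -/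
def krylovDet (A : Matrix (Fin n) (Fin n) R) : R := (krylov A (lastVec n R)).det

theorem map_krylovDet {R' : Type*} [CommRing R'] (f : R →+* R') (A : Matrix (Fin n) (Fin n) R) :
    f (krylovDet A) = krylovDet (A.map f) := by
  rw [krylovDet, krylovDet, RingHom.map_det, RingHom.mapMatrix_apply, ← krylov_map,
    map_comp_lastVec]

/-- Coordinates of the pair `(J, J)`, with `J` the nilpotent Jordan block. -/
def jordanParam (n : ℕ) (R : Type*) [CommRing R] : ParamIndex n → R :=
  Sum.elim (fun p ↦ if (p.1.1 : ℕ) + 1 = p.1.2 then 1 else 0)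
    (fun k ↦ if (k : ℕ) = 1 then 1 else 0)

theorem upperPart_jordanParam_apply (i j : Fin n) :
    upperPart (jordanParam n R) i j = if (i : ℕ) + 1 = j then 1 else 0 := by
  by_cases h : i ≤ j
  · simp [upperPart, jordanParam, h]
  · have : (i : ℕ) + 1 ≠ j := fun h' ↦ h (Fin.le_def.mpr (by omega))
    simp [upperPart, h, this]

theorem polyPart_jordanParam :
    polyPart (jordanParam n R) = upperPart (jordanParam n R) := by
  rw [polyPart]
  by_cases hn : 1 < n
  · rw [Finset.sum_eq_single ⟨1, hn⟩]
    · simp [jordanParam]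
    · intro k _ hk
      have : (k : ℕ) ≠ 1 := fun h ↦ hk (Fin.ext h)
      simp [jordanParam, this]
    · simp
  · ext i j
    have hi : (i : ℕ) + 1 ≠ j := by omega
    rw [upperPart_jordanParam_apply, if_neg hi, Matrix.sum_apply]
    refine Finset.sum_eq_zero fun k _ ↦ ?_
    have : (k : ℕ) ≠ 1 := by omega
    simp [jordanParam, this]

theorem upperPart_jordanParam_pow_mulVec (k : ℕ) (i : Fin n) :
    (upperPart (jordanParam n R) ^ k *ᵥ lastVec n R) i =
      if (i : ℕ) + k + 1 = n then 1 else 0 := by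
  induction k generalizing i with
  | zero => simp [lastVec]
  | succ k ih =>
    rw [pow_succ', ← Matrix.mulVec_mulVec, Matrix.mulVec, dotProduct]
    simp_rw [ih, upperPart_jordanParam_apply]
    by_cases hi : (i : ℕ) + 1 < n
    · rw [Finset.sum_eq_single ⟨i + 1, hi⟩]
      · simp [add_comm, add_left_comm]
      · intro j _ hj
        have : (i : ℕ) + 1 ≠ j := fun h ↦ hj (Fin.ext h.symm)
        simp [this]
      · simp
    · rw [if_neg (by omega)]
      refine Finset.sum_eq_zero fun j _ ↦ ?_
      have : (i : ℕ) + 1 ≠ j := by omega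
      simp [this]

theorem krylovDet_upperPart_jordanParam_ne_zero [Nontrivial R] :
    krylovDet (upperPart (jordanParam n R)) ≠ 0 := by
  have : krylov (upperPart (jordanParam n R)) (lastVec n R) =
      Equiv.Perm.permMatrix R (Fin.revPerm (n := n)) := by
    ext i j
    rw [krylov, Matrix.of_apply, upperPart_jordanParam_pow_mulVec, Equiv.Perm.permMatrix,
      PEquiv.toMatrix_apply]
    simp [Fin.ext_iff, Fin.val_rev]
    grind
  rw [krylovDet, this, Matrix.det_permutation]
  exact ((Int.isUnit_iff.mp (Units.isUnit (Equiv.Perm.sign _))).elim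
    (fun h ↦ by rw [h]; simp) (fun h ↦ by rw [h]; simp))

theorem exists_paramPair_eq {K : Type*} [Field K] [IsAlgClosed K] {x : Pt n K}
    (hx : x ∈ CTset n K) (hreg : (minpoly K (Xof x)).natDegree = n) :
    ∃ a, paramPair a = x := by
  obtain ⟨hX, -, hcomm⟩ := hx
  obtain ⟨c, hc⟩ := exists_eq_sum_smul_pow_of_commute hreg hcomm
  let a : ParamIndex n → K := Sum.elim (fun p ↦ Xof x p.1.1 p.1.2) c
  have ha : upperPart a = Xof x := by
    ext i j
    by_cases h : i ≤ j
    · simp [upperPart, a, h]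
    · simp [upperPart, h, hX i j (not_le.mp h)]
  have ha' : polyPart a = Yof x := by rw [hc, polyPart, ha]; rfl
  refine ⟨a, funext fun p ↦ ?_⟩
  rcases p with p | p
  · exact congrFun (congrFun ha p.1) p.2
  · exact congrFun (congrFun ha' p.1) p.2

theorem card_paramIndex (n : ℕ) : Nat.card (ParamIndex n) = n * (n + 3) / 2 := by
  have h : Fintype.card {p : Fin n × Fin n // p.1 ≤ p.2} = ∑ j : Fin n, ((j : ℕ) + 1) := by
    rw [Fintype.card_subtype, Finset.card_filter, Fintype.sum_prod_type_right]
    refine Finset.sum_congr rfl fun j _ ↦ ?_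
    rw [← Finset.card_filter, ← Fin.card_Iic j]
    congr 1
    ext i
    simp
  rw [Nat.card_eq_fintype_card, Fintype.card_sum, h, Fintype.card_fin,
    Finset.sum_add_distrib, Fin.sum_univ_eq_sum_range (fun i ↦ i), Finset.sum_range_id]
  simp only [Finset.sum_const, Finset.card_univ, Fintype.card_fin, smul_eq_mul, mul_one]
  rcases n with _ | n
  · rfl
  · have : (n + 1) * (n + 1 + 3) = (n + 1) * (n + 1 - 1) + (n + 1) * 2 * 2 := by
      rw [Nat.add_sub_cancel]; ring
    omega

end Parametrization

section Dimension

variable (n : ℕ) (K : Type*) [Field K]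

/-- The pullback of polynomial functions along `paramPair`. -/
noncomputable def paramHom : MvPolynomial ((Fin n × Fin n) ⊕ (Fin n × Fin n)) K →ₐ[K]
    MvPolynomial (ParamIndex n) K :=
  MvPolynomial.aeval (paramPair MvPolynomial.X)

variable {n K}

theorem eval_paramHom (a : ParamIndex n → K)
    (p : MvPolynomial ((Fin n × Fin n) ⊕ (Fin n × Fin n)) K) :
    MvPolynomial.eval a (paramHom n K p) = MvPolynomial.eval (paramPair a) p := by
  have hX : MvPolynomial.eval a ∘ MvPolynomial.X = a := funext fun i ↦ MvPolynomial.eval_X i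
  have hpair : MvPolynomial.eval a ∘ paramPair MvPolynomial.X = paramPair a := by
    rw [paramPair_map, hX]
  induction p using MvPolynomial.induction_on with
  | C c => rw [← MvPolynomial.algebraMap_eq, AlgHom.commutes, MvPolynomial.algebraMap_eq,
      MvPolynomial.algebraMap_eq, MvPolynomial.eval_C, MvPolynomial.eval_C]
  | add p q hp hq => simp only [map_add, hp, hq]
  | mul_X p i hp =>
    rw [map_mul, map_mul, map_mul, hp, MvPolynomial.eval_X, ← hpair, paramHom,
      MvPolynomial.aeval_X, Function.comp_apply]

theorem Xof_map_paramHom : (Xof MvPolynomial.X).map (paramHom n K).toRingHom =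
    upperPart (MvPolynomial.X (R := K) : ParamIndex n → _) := by
  ext1 i j
  exact MvPolynomial.aeval_X _ _

theorem Yof_map_paramHom : (Yof MvPolynomial.X).map (paramHom n K).toRingHom =
    polyPart (MvPolynomial.X (R := K) : ParamIndex n → _) := by
  ext1 i j
  exact MvPolynomial.aeval_X _ _

/-- The set of commuting pairs of regular upper triangular matrices. -/
def regularPairs (n : ℕ) (K : Type*) [Field K] : Set (Pt n K) :=
  {x | x ∈ CTset n K ∧ (minpoly K (Xof x)).natDegree = n ∧ (minpoly K (Yof x)).natDegree = n}

theorem vanishingIdeal_regularPairs [IsAlgClosed K] :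
    MvPolynomial.vanishingIdeal K (regularPairs n K) = RingHom.ker (paramHom n K) := by
  ext p
  rw [RingHom.mem_ker]
  constructor
  · intro hp
    let g : MvPolynomial (ParamIndex n) K :=
      krylovDet (upperPart MvPolynomial.X) * krylovDet (polyPart MvPolynomial.X)
    have hg (a : ParamIndex n → K) : MvPolynomial.eval a g =
        krylovDet (upperPart a) * krylovDet (polyPart a) := by
      have hX : MvPolynomial.eval a ∘ MvPolynomial.X = a := funext fun i ↦ by simp
      rw [map_mul, map_krylovDet, map_krylovDet, upperPart_map, polyPart_map, hX]
    have hg0 : g ≠ 0 := by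
      intro h
      have := hg (jordanParam n K)
      rw [h, map_zero, polyPart_jordanParam] at this
      exact mul_self_ne_zero.mpr krylovDet_upperPart_jordanParam_ne_zero this.symm
    refine (mul_eq_zero.mp (MvPolynomial.funext fun a ↦ ?_ : paramHom n K p * g = 0)).resolve_right
      hg0
    rw [map_mul, map_zero, eval_paramHom, hg]
    by_cases h : krylovDet (upperPart a) * krylovDet (polyPart a) = 0
    · rw [h, mul_zero]
    · have : paramPair a ∈ regularPairs n K := ⟨paramPair_mem_CTset a,
        natDegree_minpoly_eq_of_det_krylov_ne_zero (left_ne_zero_of_mul h),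
        natDegree_minpoly_eq_of_det_krylov_ne_zero (right_ne_zero_of_mul h)⟩
      have hpa : MvPolynomial.eval (paramPair a) p = 0 := hp _ this
      rw [hpa, zero_mul]
  · rintro hp x ⟨hx, hreg, -⟩
    obtain ⟨a, rfl⟩ := exists_paramPair_eq hx hreg
    exact (eval_paramHom a p).symm.trans (by rw [hp, map_zero])

theorem CT0_eq_zeroLocus [IsAlgClosed K] :
    CT0 n K = MvPolynomial.zeroLocus K (RingHom.ker (paramHom n K)) := by
  rw [← vanishingIdeal_regularPairs, ← closure_eq_zeroLocus_vanishingIdeal]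
  rfl

/-- The coefficients `c` are rational functions of the pair `(X, ∑ k, c k • X ^ k)`. -/
theorem isAlgebraic_range_paramHom :
    Algebra.IsAlgebraic (paramHom n K).range (MvPolynomial (ParamIndex n) K) := by
  have hinr (k : Fin n) : IsAlgebraic (paramHom n K).range
      (MvPolynomial.X (Sum.inr k) : MvPolynomial (ParamIndex n) K) := by
    let M := krylov (Xof (MvPolynomial.X (R := K) : (Fin n × Fin n) ⊕ (Fin n × Fin n) → _))
      (lastVec n _)
    let w := Yof (MvPolynomial.X (R := K) : (Fin n × Fin n) ⊕ (Fin n × Fin n) → _) *ᵥ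
      lastVec n _
    let f := (paramHom n K).toRingHom
    have hM : M.map f = krylov (upperPart MvPolynomial.X) (lastVec n _) := by
      rw [← krylov_map, Xof_map_paramHom, map_comp_lastVec]
    have hw : f ∘ w = M.map f *ᵥ fun k ↦ MvPolynomial.X (Sum.inr k) := by
      rw [hM, krylov_mulVec]
      funext i
      rw [Function.comp_apply, RingHom.map_mulVec, Yof_map_paramHom, map_comp_lastVec]
      rfl
    have hdet : f M.det ≠ 0 := by
      intro h
      rw [RingHom.map_det, RingHom.mapMatrix_apply, hM] at h
      change krylovDet (upperPart MvPolynomial.X) = 0 at h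
      have h' := congrArg (MvPolynomial.eval (jordanParam n K)) h
      rw [map_krylovDet, upperPart_map, map_zero] at h'
      refine krylovDet_upperPart_jordanParam_ne_zero (n := n) (R := K) (h' ▸ ?_)
      congr 2
      funext i
      simp
    have hadj : f ((M.adjugate *ᵥ w) k) = f M.det * MvPolynomial.X (Sum.inr k) := by
      rw [RingHom.map_mulVec, hw, Matrix.mulVec_mulVec, ← RingHom.mapMatrix_apply,
        ← RingHom.mapMatrix_apply, ← map_mul, Matrix.adjugate_mul,
        RingHom.mapMatrix_apply, Matrix.map_smul' f _ _ (map_mul f),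
        Matrix.map_one f f.map_zero f.map_one, Matrix.smul_mulVec, Matrix.one_mulVec, Pi.smul_apply, smul_eq_mul]
    let d : (paramHom n K).range := ⟨f M.det, M.det, rfl⟩
    let e : (paramHom n K).range := ⟨f ((M.adjugate *ᵥ w) k), _, rfl⟩
    refine ⟨C d * X - C e, fun h ↦ hdet ?_, ?_⟩
    · have := congrArg (fun q ↦ (q.coeff 1 : (paramHom n K).range)) h
      simpa [d] using congrArg Subtype.val this
    · simp [d, e, hadj, Algebra.algebraMap_eq_smul_one, Subalgebra.smul_def]
  refine ⟨fun p ↦ ?_⟩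
  induction p using MvPolynomial.induction_on with
  | C a => exact isAlgebraic_algebraMap (algebraMap K (paramHom n K).range a)
  | add p q hp hq => exact hp.add hq
  | mul_X p i hp =>
    refine hp.mul ?_
    rcases i with ⟨⟨i, j⟩, hij⟩ | k
    · refine isAlgebraic_algebraMap (⟨_, MvPolynomial.X (Sum.inl (i, j)), ?_⟩ :
        (paramHom n K).range)
      rw [paramHom]
      refine (MvPolynomial.aeval_X _ _).trans ?_
      exact dif_pos hij
    · exact hinr k

theorem ringKrullDim_quotient_ker_paramHom :
    ringKrullDim (MvPolynomial ((Fin n × Fin n) ⊕ (Fin n × Fin n)) K ⧸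
      RingHom.ker (paramHom n K)) = (n * (n + 3) / 2 : ℕ) := by
  have := isAlgebraic_range_paramHom (n := n) (K := K)
  have htr := trdeg_add_eq K (paramHom n K).range (A := MvPolynomial (ParamIndex n) K)
  rw [trdeg_eq_zero (R := (paramHom n K).range)
      (A := MvPolynomial (ParamIndex n) K), add_zero, MvPolynomial.trdeg_of_isDomain,
    Cardinal.mk_fintype, ← Nat.card_eq_fintype_card, card_paramIndex, Cardinal.lift_natCast] at htr
  have : Algebra.FiniteType K (paramHom n K).range :=
    .of_surjective (paramHom n K).rangeRestrict (paramHom n K).rangeRestrict_surjective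
  rw [← ringKrullDim_eq_of_trdeg_eq K (paramHom n K).range htr]
  exact ringKrullDim_eq_of_ringEquiv (Ideal.quotientKerEquivRange (paramHom n K)).toRingEquiv

end Dimension

theorem stmt2 (n : ℕ) (K : Type*) [Field K] [IsAlgClosed K] :
    IsIrreducible (CT0 n K) ∧
    topologicalKrullDim (CT0 n K) = ((n * (n + 3) / 2 : ℕ) : WithBot ℕ∞) := by
  have : (RingHom.ker (paramHom n K)).IsPrime := RingHom.ker_isPrime _
  rw [CT0_eq_zeroLocus, topologicalKrullDim_zeroLocus, ringKrullDim_quotient_ker_paramHom]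
  exact ⟨isIrreducible_zeroLocus _, rfl⟩
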